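/- arXiv:1705.02230 — 2 statements merged into one kernel-verified Lean document; each statement's English description precedes it below -/
import Mathlib

section
/- Let (R, m) be a local regular domain of dimension n > 1 with regular system of parameters x₁, ..., xₙ, and let φ: R[Y₂,...,Yₙ] → S := R[x₂/x₁, ..., xₙ/x₁] be the R-algebra homomorphism sending Yⱼ to xⱼ/x₁. Then ker φ = (x₁Y₂ − x₂, ..., x₁Yₙ − xₙ)R[Y₂,...,Yₙ]. -/
set_option synthInstance.maxHeartbeats 1000000
set_option maxHeartbeats 2000000

open IsLocalRing

noncomputable section

/-- The ideal generated by the nonunits of a ring (the maximal ideal, if the ring is local). -/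
def nuIdeal (A : Type*) [CommRing A] : Ideal A := Ideal.span {a : A | ¬ IsUnit a}

/-- A commutative ring is regular local if it is a Noetherian local ring whose maximal ideal
can be generated by `dim` elements. -/
def IsRegLoc (A : Type*) [CommRing A] : Prop :=
  IsLocalRing A ∧ IsNoetherianRing A ∧
    ∃ s : Finset A, (Ideal.span (s : Set A) = nuIdeal A) ∧
      ((s.card : ℕ) : WithBot (WithTop ℕ)) = ringKrullDim A

theorem quotient_span_of_sup_eq_maximalIdeal {R : Type*} [CommRing R] [IsLocalRing R]
    [IsNoetherianRing R] (t u : Finset R)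
    (h : Ideal.span (t : Set R) ⊔ Ideal.span (u : Set R) = maximalIdeal R)
    (hd : ((t.card + u.card : ℕ) : WithBot ℕ∞) ≤ ringKrullDim R) :
    ∃ _ : IsLocalRing (R ⧸ Ideal.span (t : Set R)), ∃ v : Finset (R ⧸ Ideal.span (t : Set R)),
      v.card ≤ u.card ∧ Ideal.span (v : Set _) = maximalIdeal (R ⧸ Ideal.span (t : Set R)) ∧
      ((u.card : ℕ) : WithBot ℕ∞) ≤ ringKrullDim (R ⧸ Ideal.span (t : Set R)) := by
  classical
  have htm : Ideal.span (t : Set R) ≤ maximalIdeal R := h ▸ le_sup_left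
  have hnt : Nontrivial (R ⧸ Ideal.span (t : Set R)) :=
    Ideal.Quotient.nontrivial_iff.mpr (ne_top_of_le_ne_top (maximalIdeal.isMaximal R).ne_top htm)
  have hloc : IsLocalRing (R ⧸ Ideal.span (t : Set R)) :=
    .of_surjective' (Ideal.Quotient.mk _) Ideal.Quotient.mk_surjective
  refine ⟨hloc, u.image (Ideal.Quotient.mk _), Finset.card_image_le, ?_, ?_⟩
  · have : IsLocalHom (Ideal.Quotient.mk (Ideal.span (t : Set R))) :=
      .of_surjective _ Ideal.Quotient.mk_surjective
    have hmap : (maximalIdeal R).map (Ideal.Quotient.mk (Ideal.span (t : Set R))) =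
        maximalIdeal _ := by
      refine le_antisymm (Ideal.map_le_iff_le_comap.mpr fun y hy => map_nonunit _ y hy)
        fun y hy => ?_
      obtain ⟨y, rfl⟩ := Ideal.Quotient.mk_surjective y
      exact Ideal.mem_map_of_mem _ fun hu => hy (hu.map _)
    rw [Finset.coe_image, ← Ideal.map_span, ← hmap, ← h, Ideal.map_sup, Ideal.map_quotient_self,
      bot_sup_eq]
  · have h1 := ringKrullDim_le_ringKrullDim_quotient_add_card t
      (fun a ha => by
        rw [IsLocalRing.ringJacobson_eq_maximalIdeal]
        exact htm (Ideal.subset_span ha))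
    have h2 := hd.trans h1
    rw [add_comm, Nat.cast_add] at h2
    exact ENat.WithBot.add_le_add_natCast_right_iff.mp h2

theorem exists_mem_maximalIdeal_notMem_sq_notMem_minimalPrimes {R : Type*} [CommRing R]
    [IsLocalRing R] [IsNoetherianRing R] (hd : ¬ ringKrullDim R ≤ 0) :
    ∃ x ∈ maximalIdeal R, x ∉ maximalIdeal R ^ 2 ∧ ∀ p ∈ minimalPrimes R, x ∉ p := by
  classical
  have hfin := minimalPrimes.finite_of_isNoetherianRing R
  by_contra! hcon
  have hsub : (maximalIdeal R : Set R) ⊆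
      ⋃ I ∈ ((insert (maximalIdeal R ^ 2) hfin.toFinset : Finset (Ideal R)) : Set (Ideal R)),
        (id I : Ideal R) := by
    intro x hx
    simp only [Finset.coe_insert, Set.Finite.coe_toFinset, Set.mem_iUnion, Set.mem_insert_iff,
      exists_prop, id, SetLike.mem_coe]
    by_cases h : x ∈ maximalIdeal R ^ 2
    · exact ⟨_, .inl rfl, h⟩
    · obtain ⟨p, hp, hxp⟩ := hcon x hx h
      exact ⟨p, .inr hp, hxp⟩
  rw [Ideal.subset_union_prime (maximalIdeal R ^ 2) (maximalIdeal R ^ 2)] at hsub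
  · obtain ⟨I, hI, hle⟩ := hsub
    rcases Finset.mem_insert.mp hI with rfl | hI
    · refine ((maximalIdeal_sq_lt_maximalIdeal R).mpr fun hf => hd ?_).not_ge hle
      exact (ringKrullDim_eq_zero_of_isField hf).le
    · have hI : I ∈ minimalPrimes R := by simpa using hI
      have hIm : I = maximalIdeal R := (le_maximalIdeal hI.1.1.ne_top).antisymm hle
      subst hIm
      rw [← maximalIdeal_height_eq_ringKrullDim, Ideal.height_eq_zero_iff.mpr hI] at hd
      exact hd le_rfl
  · intro I hI h _
    have hI : I ∈ minimalPrimes R := by simpa [h] using hI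
    exact hI.1.1

theorem exists_mem_span_insert_erase_eq {R : Type*} [CommRing R] [IsLocalRing R] [DecidableEq R]
    (s : Finset R) (hs : Ideal.span (s : Set R) = maximalIdeal R) (x : R)
    (hx : x ∈ maximalIdeal R) (hx2 : x ∉ maximalIdeal R ^ 2) :
    ∃ a ∈ s, Ideal.span (({x} : Finset R) : Set R) ⊔ Ideal.span ((s.erase a : Finset R) : Set R) =
      maximalIdeal R := by
  have hsm : ∀ a ∈ s, a ∈ maximalIdeal R := fun a ha => hs ▸ Ideal.subset_span ha
  obtain ⟨f, -, hf⟩ := Submodule.mem_span_finset.mp (hs.ge hx)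
  have : ∃ a ∈ s, IsUnit (f a) := by
    by_contra! h
    refine hx2 (hf ▸ Ideal.sum_mem _ fun a ha => ?_)
    rw [pow_two]
    exact Ideal.mul_mem_mul (h a ha) (hsm a ha)
  obtain ⟨a, ha, hu⟩ := this
  refine ⟨a, ha, le_antisymm (sup_le ?_ ?_) ?_⟩
  · simpa [Ideal.span_le] using hx
  · rw [Ideal.span_le]
    exact fun b hb => hsm b (Finset.mem_of_mem_erase hb)
  · rw [← hs, Ideal.span_le]
    intro b hb
    by_cases hba : b = a
    · subst hba
      rw [SetLike.mem_coe, ← Ideal.unit_mul_mem_iff_mem _ hu]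
      rw [← Finset.add_sum_erase _ _ ha, ← eq_sub_iff_add_eq] at hf
      rw [← smul_eq_mul, hf]
      refine Ideal.sub_mem _ (Ideal.mem_sup_left (Ideal.subset_span (by simp)))
        (Ideal.mem_sup_right (Ideal.sum_mem _ fun c hc =>
          Ideal.mul_mem_left _ _ (Ideal.subset_span hc)))
    · exact Ideal.mem_sup_right (Ideal.subset_span (by simpa [hba] using hb))

theorem isDomain_of_prime_span_singleton {R : Type*} [CommRing R] [IsLocalRing R]
    [IsNoetherianRing R] (x : R) (hx : x ∈ maximalIdeal R) (hp : (Ideal.span {x}).IsPrime)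
    (hmin : ∀ p ∈ minimalPrimes R, x ∉ p) : IsDomain R := by
  obtain ⟨p, hpm, hle⟩ := Ideal.exists_minimalPrimes_le (J := Ideal.span {x}) bot_le
  have hpp : p.IsPrime := hpm.1.1
  have hbot : p = ⊥ := by
    refine Submodule.eq_bot_of_le_smul_of_le_jacobson_bot (Ideal.span {x}) p
      (IsNoetherian.noetherian p) ?_ ?_
    · intro y hy
      obtain ⟨z, rfl⟩ := Ideal.mem_span_singleton'.mp (hle hy)
      have hz : z ∈ p := (hpp.mem_or_mem hy).resolve_right (hmin p hpm)
      rw [mul_comm]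
      exact Submodule.smul_mem_smul (Ideal.mem_span_singleton_self x) hz
    · rw [IsLocalRing.jacobson_eq_maximalIdeal _ bot_ne_top, Ideal.span_le]
      simpa using hx
  rw [hbot] at hpp
  exact IsDomain.of_bot_isPrime R

/-- A Noetherian local ring whose maximal ideal is generated by at most `dim R` elements is a
domain. -/
theorem isDomain_of_card_le_ringKrullDim (n : ℕ) : ∀ {R : Type*} [CommRing R] [IsLocalRing R]
    [IsNoetherianRing R] (s : Finset R), s.card ≤ n → (n : WithBot ℕ∞) ≤ ringKrullDim R →
    Ideal.span (s : Set R) = maximalIdeal R → IsDomain R := by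
  classical
  induction n with
  | zero =>
    intro R _ _ _ s hsn _ hs
    obtain rfl : s = ∅ := by simpa using hsn
    have : IsField R := isField_iff_maximalIdeal_eq.mpr (by simpa using hs.symm)
    exact this.isDomain
  | succ n ih =>
    intro R _ _ _ s hsn hd hs
    obtain ⟨x, hx, hx2, hmin⟩ := exists_mem_maximalIdeal_notMem_sq_notMem_minimalPrimes (R := R)
      fun h => by
        have := hd.trans h
        norm_cast at this
    obtain ⟨a, ha, hsup⟩ := exists_mem_span_insert_erase_eq s hs x hx hx2
    have hc := Finset.card_erase_add_one ha
    have hds : (s.card : WithBot ℕ∞) ≤ ringKrullDim R := le_trans (by exact_mod_cast hsn) hd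
    have hge : n + 1 ≤ s.card := by
      have h1 := hd.trans (ringKrullDim_le_spanFinrank_maximalIdeal R)
      rw [← hs] at h1
      have h2 : (Ideal.span (s : Set R)).spanFinrank ≤ _ :=
        Submodule.spanFinrank_span_le_ncard_of_finite s.finite_toSet
      rw [Set.ncard_coe_finset] at h2
      exact le_trans (by exact_mod_cast h1) h2
    obtain ⟨_, v, hv, hvm, hvd⟩ := quotient_span_of_sup_eq_maximalIdeal {x} (s.erase a) hsup
      (by rw [Finset.card_singleton, add_comm, hc]; exact hds)
    have := ih v (by omega) (by convert hvd; omega) hvm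
    rw [Ideal.Quotient.isDomain_iff_prime, Finset.coe_singleton] at this
    exact isDomain_of_prime_span_singleton x hx this hmin

theorem isPrime_span_image_of_card_le {R ι : Type*} [CommRing R] [IsLocalRing R]
    [IsNoetherianRing R] [Fintype ι] (x : ι → R)
    (hx : Ideal.span (Set.range x) = maximalIdeal R)
    (hd : (Fintype.card ι : WithBot ℕ∞) ≤ ringKrullDim R) (s : Finset ι) :
    (Ideal.span (x '' s)).IsPrime := by
  classical
  obtain ⟨_, v, hv, hvm, hvd⟩ := quotient_span_of_sup_eq_maximalIdeal (s.image x) (sᶜ.image x)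
    (by
      rw [← Ideal.span_union, ← hx, ← Finset.coe_union, ← Finset.image_union,
        Finset.union_compl, Finset.coe_image, Finset.coe_univ, Set.image_univ])
    (le_trans (by
      rw [← Finset.card_add_card_compl s]
      exact_mod_cast Nat.add_le_add Finset.card_image_le Finset.card_image_le) hd)
  have := isDomain_of_card_le_ringKrullDim _ v hv hvd hvm
  rwa [Ideal.Quotient.isDomain_iff_prime, Finset.coe_image] at this

theorem notMem_span_image_of_card_le {R ι : Type*} [CommRing R] [IsLocalRing R]
    [IsNoetherianRing R] [Fintype ι] (x : ι → R)
    (hx : Ideal.span (Set.range x) = maximalIdeal R)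
    (hd : (Fintype.card ι : WithBot ℕ∞) ≤ ringKrullDim R) (s : Finset ι) (j : ι) (hj : j ∉ s) :
    x j ∉ Ideal.span (x '' s) := by
  classical
  intro hmem
  have hspan : Ideal.span (((Finset.univ.erase j).image x : Finset R) : Set R) =
      maximalIdeal R := by
    rw [← hx]
    refine le_antisymm (Ideal.span_mono (by simp)) (Ideal.span_le.mpr ?_)
    rintro _ ⟨i, rfl⟩
    by_cases hij : i = j
    · subst hij
      refine Ideal.span_mono ?_ hmem
      rw [Finset.coe_image]
      exact Set.image_mono fun k hk => by
        simpa using fun h : k = i => hj (h ▸ hk)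
    · exact Ideal.subset_span (Finset.mem_coe.mpr (Finset.mem_image_of_mem _ (by simpa using hij)))
  have h1 := hd.trans (ringKrullDim_le_spanFinrank_maximalIdeal R)
  rw [← hspan] at h1
  have h2 : (Ideal.span (((Finset.univ.erase j).image x : Finset R) : Set R)).spanFinrank ≤ _ :=
    Submodule.spanFinrank_span_le_ncard_of_finite (Finset.finite_toSet _)
  rw [Set.ncard_coe_finset] at h2
  have h3 : Fintype.card ι ≤ _ := Nat.cast_le.mp h1
  have h4 := Finset.card_erase_lt_of_mem (Finset.mem_univ j)
  have h5 := Finset.card_image_le (s := Finset.univ.erase j) (f := x)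
  rw [Finset.card_univ] at h4
  omega

/-- Every linear relation between the elements of a family that is regular in every order is a
combination of the trivial relations. -/
theorem exists_sum_sub_mul_of_sum_mul_eq_zero {A ι : Type*} [CommRing A] (X : ι → A)
    (hX : ∀ (s : Finset ι) (j : ι), j ∉ s → ∀ c : A, c * X j ∈ Ideal.span (X '' s) →
      c ∈ Ideal.span (X '' s)) (s : Finset ι) :
    ∀ g : ι → A, ∑ i ∈ s, g i * X i = 0 →
      ∃ b : ι → ι → A, ∀ i ∈ s, g i = ∑ j ∈ s, (b i j - b j i) * X j := by
  classical
  induction s using Finset.induction_on with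
  | empty => exact fun _ _ => ⟨0, by simp⟩
  | insert k s hk ih =>
    intro g hg
    rw [Finset.sum_insert hk] at hg
    have hmem : g k ∈ Ideal.span (X '' s) := by
      refine hX s k hk _ ?_
      rw [eq_neg_of_add_eq_zero_left hg]
      exact neg_mem (Ideal.sum_mem _ fun i hi =>
        Ideal.mul_mem_left _ _ (Ideal.subset_span ⟨i, hi, rfl⟩))
    obtain ⟨c, hc⟩ := (Submodule.mem_span_image_finset_iff_exists_fun' A).mp hmem
    simp only [smul_eq_mul] at hc
    obtain ⟨b, hb⟩ := ih (fun i => g i + c i * X k) (by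
      rw [← hg, ← hc, Finset.sum_mul, ← Finset.sum_add_distrib]
      exact Finset.sum_congr rfl fun i _ => by ring)
    refine ⟨fun i j => if i = k then c j else if j = k then 0 else b i j, fun i hi => ?_⟩
    have hne : ∀ j ∈ s, j ≠ k := fun j hj h => hk (h ▸ hj)
    rw [Finset.sum_insert hk]
    rcases Finset.mem_insert.mp hi with rfl | hi
    · rw [← hc, sub_self, zero_mul, zero_add]
      exact Finset.sum_congr rfl fun j hj => by simp [hne j hj]
    · beta_reduce
      rw [← sub_eq_iff_eq_add', if_neg (hne i hi), if_pos rfl, if_pos rfl, zero_sub, neg_mul,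
        sub_neg_eq_add, hb i hi]
      exact Finset.sum_congr rfl fun j hj => by simp [hne j hj, hne i hi]

theorem mem_span_of_mul_mem_span {A ι : Type*} [CommRing A] [IsDomain A] [Fintype ι] (X Y : ι → A)
    (hX : ∀ (s : Finset ι) (j : ι), j ∉ s → ∀ c : A, c * X j ∈ Ideal.span (X '' s) →
      c ∈ Ideal.span (X '' s)) (i₀ : ι) (hY : Y i₀ = 1) (h0 : X i₀ ≠ 0) (h : A)
    (hh : X i₀ * h ∈ Ideal.span (Set.range fun i => X i₀ * Y i - X i)) :
    h ∈ Ideal.span (Set.range fun i => X i₀ * Y i - X i) := by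
  classical
  obtain ⟨g, hg⟩ := Ideal.mem_span_range_iff_exists_fun.mp hh
  set u : A := h - ∑ i, g i * Y i with hu
  obtain ⟨b, hb⟩ := exists_sum_sub_mul_of_sum_mul_eq_zero X hX Finset.univ
    (fun i => g i + if i = i₀ then u else 0) (by
      simp only [add_mul, ite_mul, zero_mul, Finset.sum_add_distrib, Finset.sum_ite_eq',
        Finset.mem_univ, if_true]
      simp only [mul_sub, Finset.sum_sub_distrib] at hg
      have : ∑ i, g i * (X i₀ * Y i) = X i₀ * ∑ i, g i * Y i := by
        rw [Finset.mul_sum]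
        exact Finset.sum_congr rfl fun i _ => by ring
      rw [hu]
      linear_combination this - hg)
  have hhY : h = ∑ i, ∑ j, (b i j - b j i) * X j * Y i := by
    have : h = ∑ i, (g i + if i = i₀ then u else 0) * Y i := by
      simp only [add_mul, ite_mul, zero_mul, Finset.sum_add_distrib, Finset.sum_ite_eq',
        Finset.mem_univ, if_true, hY, hu]
      ring
    rw [this]
    exact Finset.sum_congr rfl fun i hi => by rw [hb i hi, Finset.sum_mul]
  have key : h = ∑ i, ∑ j, (b i j - b j i) * Y j * (X i₀ * Y i - X i) := by
    refine mul_left_cancel₀ h0 ?_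
    have hanti : ∀ Z : ι → A, ∑ i, ∑ j, (b i j - b j i) * Z i * Z j = 0 := fun Z => by
      simp only [sub_mul, Finset.sum_sub_distrib]
      rw [sub_eq_zero]
      conv_lhs => rw [Finset.sum_comm]
      exact Finset.sum_congr rfl fun i _ => Finset.sum_congr rfl fun j _ => by ring
    have h1 : X i₀ * h - X i₀ * ∑ i, ∑ j, (b i j - b j i) * Y j * (X i₀ * Y i - X i) =
        ∑ i, ∑ j, (b i j - b j i) * X i * X j - ∑ i, ∑ j, (b i j - b j i) *
          (X i₀ * Y i - X i) * (X i₀ * Y j - X j) := by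
      nth_rw 1 [hhY]
      simp only [Finset.mul_sum, ← Finset.sum_sub_distrib]
      exact Finset.sum_congr rfl fun i _ => Finset.sum_congr rfl fun j _ => by ring
    rw [hanti, hanti fun i => X i₀ * Y i - X i, sub_zero] at h1
    exact sub_eq_zero.mp h1
  rw [key]
  exact Ideal.sum_mem _ fun i _ => Ideal.sum_mem _ fun j _ =>
    Ideal.mul_mem_left _ _ (Ideal.subset_span ⟨i, rfl⟩)

theorem exists_pow_mul_sub_C_mem_span {R σ : Type*} [CommRing R] (a : R) (y : σ → R)
    (p : MvPolynomial σ R) : ∃ (N : ℕ) (c : R),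
    MvPolynomial.C a ^ N * p - MvPolynomial.C c ∈ Ideal.span (Set.range fun i : σ =>
      MvPolynomial.C a * MvPolynomial.X i - MvPolynomial.C (y i)) := by
  induction p using MvPolynomial.induction_on with
  | C r => exact ⟨0, r, by simp⟩
  | add p q hp hq =>
    obtain ⟨N, c, hp⟩ := hp
    obtain ⟨M, d, hq⟩ := hq
    refine ⟨N + M, a ^ M * c + a ^ N * d, ?_⟩
    convert Ideal.add_mem _ (Ideal.mul_mem_left _ (MvPolynomial.C a ^ M) hp)
      (Ideal.mul_mem_left _ (MvPolynomial.C a ^ N) hq) using 1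
    simp only [map_add, map_mul, map_pow]
    ring
  | mul_X p i hp =>
    obtain ⟨N, c, hp⟩ := hp
    refine ⟨N + 1, c * y i, ?_⟩
    convert Ideal.add_mem _
      (Ideal.mul_mem_left _ (MvPolynomial.C a * MvPolynomial.X i) hp)
      (Ideal.mul_mem_left _ (MvPolynomial.C c) (Ideal.subset_span ⟨i, rfl⟩)) using 1
    simp only [map_mul]
    ring

theorem mem_span_image_C_of_mul_mem {R σ ι : Type*} [CommRing R] (x : ι → R) (s : Finset ι)
    (j : ι) (hp : (Ideal.span (x '' s)).IsPrime) (hj : x j ∉ Ideal.span (x '' s))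
    (c : MvPolynomial σ R)
    (hc : c * MvPolynomial.C (x j) ∈ Ideal.span ((fun i => MvPolynomial.C (x i)) '' (s : Set ι))) :
    c ∈ Ideal.span ((fun i => MvPolynomial.C (σ := σ) (x i)) '' (s : Set ι)) := by
  have h : Ideal.span ((fun i => MvPolynomial.C (σ := σ) (x i)) '' (s : Set ι)) =
      (Ideal.span (x '' s)).map MvPolynomial.C := by
    rw [Ideal.map_span, Set.image_image]
  rw [h] at hc ⊢
  rw [MvPolynomial.mem_map_C_iff] at hc ⊢
  intro m
  have := hc m
  rw [mul_comm, MvPolynomial.coeff_C_mul] at this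
  exact (hp.mem_or_mem this).resolve_left hj

/-- Let `(R, m)` be a local regular domain of dimension `n > 1` with regular
system of parameters `x₁, ..., xₙ`, and let `φ : R[Y₂,...,Yₙ] → S := R[x₂/x₁,...,xₙ/x₁]` be the
`R`-algebra homomorphism sending `Yⱼ` to `xⱼ/x₁` (computed in the fraction field of `R`; the
kernel is unchanged upon replacing the codomain `S` by the fraction field).  Then
`ker φ = (x₁Y₂ − x₂, ..., x₁Yₙ − xₙ)R[Y₂,...,Yₙ]`. -/
theorem ker_aeval_eq_span (R : Type*) [CommRing R] [IsDomain R] [IsLocalRing R]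
    (n : ℕ) (hn : 1 < n) (hreg : IsRegLoc R)
    (hdim : ringKrullDim R = (n : ℕ))
    (x : Fin n → R) (hx : Ideal.span (Set.range x) = maximalIdeal R)
    (i0 : Fin n) (hi0 : (i0 : ℕ) = 0)
    (φ : MvPolynomial {i : Fin n // i ≠ i0} R →ₐ[R] FractionRing R)
    (hφ : φ = MvPolynomial.aeval fun i : {i : Fin n // i ≠ i0} =>
      algebraMap R (FractionRing R) (x i) / algebraMap R (FractionRing R) (x i0)) :
    RingHom.ker φ.toRingHom =
      Ideal.span (Set.range fun i : {i : Fin n // i ≠ i0} =>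
        MvPolynomial.C (x i0) * MvPolynomial.X i - MvPolynomial.C (x i.val)) := by
  classical
  have : IsNoetherianRing R := hreg.2.1
  have hd : (Fintype.card (Fin n) : WithBot ℕ∞) ≤ ringKrullDim R := by
    rw [hdim, Fintype.card_fin]
  have hprime := isPrime_span_image_of_card_le x hx hd
  have hnot := notMem_span_image_of_card_le x hx hd
  have hx0 : x i0 ≠ 0 := fun h => hnot ∅ i0 (by simp) (h ▸ Ideal.zero_mem _)
  have hx0' : algebraMap R (FractionRing R) (x i0) ≠ 0 := by
    simpa using hx0
  have hle : Ideal.span (Set.range fun i : {i : Fin n // i ≠ i0} =>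
      MvPolynomial.C (x i0) * MvPolynomial.X i - MvPolynomial.C (x i.val)) ≤
      RingHom.ker φ.toRingHom := by
    rw [Ideal.span_le]
    rintro _ ⟨i, rfl⟩
    have : φ (MvPolynomial.C (x i0) * MvPolynomial.X i - MvPolynomial.C (x i.val)) = 0 := by
      subst hφ
      simp [mul_div_cancel₀, hx0']
    exact this
  refine le_antisymm (fun f hf => ?_) hle
  obtain ⟨N, c, hNc⟩ := exists_pow_mul_sub_C_mem_span (x i0)
    (fun i : {i : Fin n // i ≠ i0} => x i) f
  have hf0 : φ f = 0 := hf
  have hc : c = 0 := by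
    have h1 : φ (MvPolynomial.C (x i0) ^ N * f - MvPolynomial.C c) = 0 := hle hNc
    rw [map_sub, map_mul, hf0, mul_zero, zero_sub, neg_eq_zero] at h1
    have h2 : algebraMap R (FractionRing R) c = 0 := by rw [← h1]; exact (φ.commutes c).symm
    simpa using h2
  rw [hc, map_zero, sub_zero] at hNc
  let Y : Fin n → MvPolynomial {i : Fin n // i ≠ i0} R := fun i =>
    if h : i = i0 then 1 else MvPolynomial.X ⟨i, h⟩
  have hspan : Ideal.span (Set.range fun i : {i : Fin n // i ≠ i0} =>
      MvPolynomial.C (x i0) * MvPolynomial.X i - MvPolynomial.C (x i.val)) =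
      Ideal.span (Set.range fun i : Fin n =>
        MvPolynomial.C (x i0) * Y i - MvPolynomial.C (x i)) := by
    refine le_antisymm (Ideal.span_le.mpr ?_) (Ideal.span_le.mpr ?_)
    · rintro _ ⟨i, rfl⟩
      exact Ideal.subset_span ⟨i, by simp [Y, i.2]⟩
    · rintro _ ⟨i, rfl⟩
      by_cases h : i = i0
      · simp [Y, h]
      · exact Ideal.subset_span ⟨⟨i, h⟩, by simp [Y, h]⟩
  rw [hspan] at hNc ⊢
  induction N with
  | zero => simpa using hNc
  | succ N ih =>
    refine ih (mem_span_of_mul_mem_span (fun i => MvPolynomial.C (x i)) Y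
      (fun s j hj c => mem_span_image_C_of_mul_mem x s j (hprime s) (hnot s j hj) c) i0
      (by simp [Y]) (by simpa using hx0) _ ?_)
    rwa [← mul_assoc, ← pow_succ']

end
end

section
/- Let (R, m) be a local regular domain of dimension n > 1, let x₁,...,xₙ generate m, and set S = R[x₂/x₁,...,xₙ/x₁]. Then S is a regular ring, i.e. S_p is a regular local ring for every prime ideal p of S. -/
set_option synthInstance.maxHeartbeats 1000000
set_option maxHeartbeats 2000000

open IsLocalRing

noncomputable section

universe u

section RegularLocal

/-- A proper principal quotient of a local ring is local. -/
lemma isLocalRing_quotient_span_singleton {L : Type*} [CommRing L] [IsLocalRing L] {x : L}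
    (hx : x ∈ maximalIdeal L) : IsLocalRing (L ⧸ Ideal.span {x}) := by
  have : Nontrivial (L ⧸ Ideal.span {x}) := Ideal.Quotient.nontrivial_iff.mpr fun h =>
    (maximalIdeal.isMaximal L).ne_top
      (top_le_iff.mp (h ▸ (Ideal.span_singleton_le_iff_mem _).mpr hx))
  exact .of_surjective' _ Ideal.Quotient.mk_surjective

/-- The embedding dimension drops by at most one modulo an element. -/
lemma spanFinrank_maximalIdeal_le_add_one {L B : Type*} [CommRing L] [IsLocalRing L]
    [CommRing B] [IsLocalRing B] [IsNoetherianRing B]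
    (f : L →+* B) (hf : Function.Surjective f) {x : L}
    (hker : RingHom.ker f = Ideal.span {x}) :
    (maximalIdeal L).spanFinrank ≤ (maximalIdeal B).spanFinrank + 1 := by
  classical
  have hloc : IsLocalHom f := hf.isLocalHom
  obtain ⟨s, hs, hspan⟩ :=
    Submodule.FG.exists_span_finset_card_eq_spanFinrank
      (maximalIdeal B).fg_of_isNoetherianRing
  have key : maximalIdeal L =
      Ideal.span (((s.image (Function.surjInv hf) ∪ {x} : Finset L) : Set L)) := by
    rw [Finset.coe_union, Finset.coe_singleton, Ideal.span_union, ← hker, Finset.coe_image,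
      ← maximalIdeal_comap f, ← Ideal.comap_map_of_surjective' f hf, Ideal.map_span]
    congr 1
    rw [← Set.image_comp, (Function.rightInverse_surjInv hf).comp_eq_id, Set.image_id]
    exact hspan.symm
  calc (maximalIdeal L).spanFinrank
      ≤ ((s.image (Function.surjInv hf) ∪ {x} : Finset L) : Set L).ncard := by
        conv_lhs => rw [key]
        exact Submodule.spanFinrank_span_le_ncard_of_finite (Finset.finite_toSet _)
    _ ≤ _ := by
        rw [Set.ncard_coe_finset, ← hs]
        exact (Finset.card_union_le _ _).trans (by simpa using Finset.card_image_le)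

/-- The embedding dimension drops modulo an element outside the square of the maximal ideal. -/
lemma spanFinrank_maximalIdeal_quotient_add_one_le {L : Type*} [CommRing L] [IsLocalRing L]
    [IsNoetherianRing L] {x : L} (hx : x ∈ maximalIdeal L) (hx2 : x ∉ maximalIdeal L ^ 2)
    [IsLocalRing (L ⧸ Ideal.span {x})] :
    (maximalIdeal (L ⧸ Ideal.span {x})).spanFinrank + 1 ≤ (maximalIdeal L).spanFinrank := by
  classical
  set m := maximalIdeal L
  have hx0 : m.toCotangent ⟨x, hx⟩ ≠ 0 := by
    rwa [ne_eq, Ideal.toCotangent_eq_zero]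
  obtain ⟨b, -, hxb, hb, hli⟩ := exists_linearIndepOn_extension (K := ResidueField L)
    (v := (id : CotangentSpace L → CotangentSpace L))
    (LinearIndepOn.singleton hx0) (Set.subset_univ _)
  have hbtop : Submodule.span (ResidueField L) b = ⊤ := by
    rw [Set.image_id, Set.image_id] at hb
    exact top_le_iff.mp fun v _ => hb trivial
  have hbfin : b.Finite := hli.linearIndependent.setFinite
  let B := Module.Basis.mk hli.linearIndependent (by simp [hbtop])
  have hcard : b.ncard = m.spanFinrank := by
    rw [spanFinrank_maximalIdeal_eq_finrank_cotangentSpace, Module.finrank_eq_nat_card_basis B]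
    rfl
  let g : CotangentSpace L → m := Function.surjInv m.toCotangent_surjective
  have hg : ∀ v, m.toCotangent (g v) = v := Function.surjInv_eq m.toCotangent_surjective
  let t : Set m := g '' (b \ {m.toCotangent ⟨x, hx⟩}) ∪ {⟨x, hx⟩}
  have ht : Submodule.span L t = ⊤ := by
    rw [← IsLocalRing.CotangentSpace.span_image_eq_top_iff, ← hbtop]
    congr 1
    simp only [t, Set.image_union, Set.image_singleton, ← Set.image_comp]
    rw [show (m.toCotangent ∘ g) = id from funext hg, Set.image_id]
    exact Set.sdiff_union_of_subset hxb
  have hm : m = Ideal.span ((fun v => (g v : L)) '' (b \ {m.toCotangent ⟨x, hx⟩}) ∪ {x}) := by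
    have := congrArg (Submodule.map m.subtype) ht
    rw [Submodule.map_span, Submodule.map_top, Submodule.range_subtype] at this
    refine this.symm.trans ?_
    simp only [t, Set.image_union, Set.image_singleton, ← Set.image_comp]
    rfl
  have hmq : maximalIdeal (L ⧸ Ideal.span {x}) = Ideal.span
      ((fun v => Ideal.Quotient.mk (Ideal.span {x}) (g v : L)) ''
        (b \ {m.toCotangent ⟨x, hx⟩})) := by
    rw [← map_maximalIdeal_of_surjective (Ideal.Quotient.mk (Ideal.span {x}))
      Ideal.Quotient.mk_surjective]
    change Ideal.map _ m = _
    conv_lhs => rw [hm]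
    rw [Ideal.span_union, Ideal.map_sup, Ideal.map_quotient_self, sup_bot_eq, Ideal.map_span,
      ← Set.image_comp]
    rfl
  have hfinS : (b \ {m.toCotangent ⟨x, hx⟩}).Finite := hbfin.sdiff
  rw [hmq, ← hcard, ← Set.ncard_sdiff_singleton_add_one (hxb rfl) hbfin]
  gcongr
  exact (Submodule.spanFinrank_span_le_ncard_of_finite (hfinS.image _)).trans
    (Set.ncard_image_le hfinS)

/-- Prime avoidance for parameters outside the square of the maximal ideal. -/
lemma exists_mem_maximalIdeal_notMem_sq {L : Type*} [CommRing L] [IsLocalRing L]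
    [IsNoetherianRing L] (hm : maximalIdeal L ≠ ⊥) {F : Set (Ideal L)} (hF : F.Finite)
    (hprime : ∀ p ∈ F, p.IsPrime) (hne : maximalIdeal L ∉ F) :
    ∃ x ∈ maximalIdeal L, x ∉ maximalIdeal L ^ 2 ∧ ∀ p ∈ F, x ∉ p := by
  classical
  by_contra! H
  have hsub : (maximalIdeal L : Set L) ⊆
      ⋃ i ∈ ((insert (maximalIdeal L ^ 2) hF.toFinset : Finset (Ideal L)) : Set (Ideal L)),
        (i : Set L) := by
    intro x hx
    by_cases h2 : x ∈ maximalIdeal L ^ 2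
    · exact Set.mem_biUnion (by simp) h2
    · obtain ⟨p, hp, hxp⟩ := H x hx h2
      exact Set.mem_biUnion (by simp [hp]) hxp
  have havoid := (Ideal.subset_union_prime (f := id) (maximalIdeal L ^ 2) (maximalIdeal L ^ 2)
    ?_).mp hsub
  · obtain ⟨i, hi, hle⟩ := havoid
    simp only [Finset.mem_insert, Set.Finite.mem_toFinset, id] at hi hle
    rcases hi with rfl | hi
    · refine hm (Submodule.eq_bot_of_le_smul_of_le_jacobson_bot (maximalIdeal L) _
        (maximalIdeal L).fg_of_isNoetherianRing ?_ (maximalIdeal_le_jacobson _))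
      rwa [smul_eq_mul, ← pow_two]
    · exact hne ((maximalIdeal.isMaximal L).eq_of_le (hprime i hi).ne_top hle ▸ hi)
  · intro i hi h _
    simp only [Finset.mem_insert, Set.Finite.mem_toFinset] at hi
    exact hprime i (hi.resolve_left h)

lemma IsRegularLocalRing.of_surjective_of_ker_eq_span {L B : Type*} [CommRing L] [IsLocalRing L]
    [IsNoetherianRing L] [CommRing B] [IsRegularLocalRing B]
    (f : L →+* B) (hf : Function.Surjective f) {x : L}
    (hker : RingHom.ker f = Ideal.span {x}) (hdim : ringKrullDim B + 1 ≤ ringKrullDim L) :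
    IsRegularLocalRing L := by
  apply IsRegularLocalRing.of_spanFinrank_maximalIdeal_le
  refine le_trans ?_ hdim
  rw [← (isRegularLocalRing_iff B).mp ‹_›]
  exact_mod_cast spanFinrank_maximalIdeal_le_add_one f hf hker

lemma IsRegularLocalRing.quotient_span_singleton {L : Type*} [CommRing L] [IsRegularLocalRing L]
    {x : L} (hx : x ∈ maximalIdeal L) (hx2 : x ∉ maximalIdeal L ^ 2) :
    IsRegularLocalRing (L ⧸ Ideal.span {x}) := by
  have := isLocalRing_quotient_span_singleton hx
  apply IsRegularLocalRing.of_spanFinrank_maximalIdeal_le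
  have h1 := spanFinrank_maximalIdeal_quotient_add_one_le hx hx2
  have h2 : ringKrullDim L ≤ ringKrullDim (L ⧸ Ideal.span {x}) + 1 := by
    rw [← maximalIdeal_height_eq_ringKrullDim]
    exact Ideal.height_le_ringKrullDim_quotient_add_one hx
  rw [← (isRegularLocalRing_iff L).mp ‹_›] at h2
  have h3 : (((maximalIdeal (L ⧸ Ideal.span {x})).spanFinrank : WithBot ℕ∞)) + 1 ≤
      ringKrullDim (L ⧸ Ideal.span {x}) + 1 := le_trans (by exact_mod_cast h1) h2
  exact (ENat.WithBot.add_le_add_natCast_right_iff (c := 1)).mp (by exact_mod_cast h3)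

lemma IsRegularLocalRing.maximalIdeal_notMem_minimalPrimes {L : Type*} [CommRing L]
    [IsRegularLocalRing L] (hm : maximalIdeal L ≠ ⊥) : maximalIdeal L ∉ minimalPrimes L := by
  intro h
  have h0 := (isRegularLocalRing_iff L).mp ‹_›
  rw [← maximalIdeal_height_eq_ringKrullDim, Ideal.height_eq_zero_iff.mpr h] at h0
  have h1 : (maximalIdeal L).spanFinrank = 0 := by exact_mod_cast h0
  exact hm ((Submodule.spanFinrank_eq_zero_iff_eq_bot
    (maximalIdeal L).fg_of_isNoetherianRing).mp h1)

/-- Regular local rings are domains. -/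
lemma IsRegularLocalRing.isDomain (L : Type u) [CommRing L] [IsRegularLocalRing L] :
    IsDomain L := by
  induction h : (maximalIdeal L).spanFinrank using Nat.strong_induction_on generalizing L with
  | _ n ih =>
  by_cases hm : maximalIdeal L = ⊥
  · exact (isField_iff_maximalIdeal_eq.mpr hm).isDomain
  obtain ⟨x, hx, hx2, hxp⟩ := exists_mem_maximalIdeal_notMem_sq hm
    (minimalPrimes.finite_of_isNoetherianRing L) (fun p hp => hp.1.1)
    (maximalIdeal_notMem_minimalPrimes hm)
  have hB := quotient_span_singleton hx hx2
  have hdom := ih _ (by have := spanFinrank_maximalIdeal_quotient_add_one_le hx hx2; omega)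
    (L ⧸ Ideal.span {x}) rfl
  have hprime : (Ideal.span {x}).IsPrime := (Ideal.Quotient.isDomain_iff_prime _).mp hdom
  obtain ⟨p, hp, hple⟩ := Ideal.exists_minimalPrimes_le (bot_le : ⊥ ≤ Ideal.span {x})
  have hpp : p.IsPrime := hp.1.1
  obtain rfl : p = ⊥ := by
    refine Submodule.eq_bot_of_le_smul_of_le_jacobson_bot (maximalIdeal L) p
      p.fg_of_isNoetherianRing ?_ (maximalIdeal_le_jacobson _)
    intro y hy
    obtain ⟨a, rfl⟩ := Ideal.mem_span_singleton'.mp (hple hy)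
    rw [mul_comm]
    exact Submodule.smul_mem_smul hx ((hpp.mem_or_mem hy).resolve_right (hxp p hp))
  exact IsDomain.of_bot_isPrime L

end RegularLocal

section FinitePD

open CategoryTheory

/-- Dimension shifting along a short exact sequence with projective middle term. -/
lemma hasProjectiveDimensionLE_succ_iff_of_exact {A : Type u} [CommRing A] {K P M : Type u}
    [AddCommGroup K] [Module A K] [AddCommGroup P] [Module A P] [AddCommGroup M] [Module A M]
    [Module.Projective A P] (f : K →ₗ[A] P) (g : P →ₗ[A] M) (hf : Function.Injective f)
    (hfg : Function.Exact f g) (hg : Function.Surjective g) (n : ℕ) :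
    HasProjectiveDimensionLE (ModuleCat.of A M) (n + 1) ↔
      HasProjectiveDimensionLE (ModuleCat.of A K) n := by
  let S := ModuleCat.shortComplexOfCompEqZero f g hfg.linearMap_comp_eq_zero
  have hS : S.ShortExact :=
    { exact := (ShortComplex.ShortExact.moduleCat_exact_iff_function_exact _).mpr hfg
      mono_f := (ModuleCat.mono_iff_injective _).mpr hf
      epi_g := (ModuleCat.epi_iff_surjective _).mpr hg }
  have h2 : Projective S.X₂ := (IsProjective.iff_projective (R := A) P).mp inferInstance
  exact hS.hasProjectiveDimensionLT_X₃_iff n h2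

lemma hasProjectiveDimensionLE_zero_iff {A : Type u} [CommRing A] {M : Type u}
    [AddCommGroup M] [Module A M] :
    HasProjectiveDimensionLE (ModuleCat.of A M) 0 ↔ Module.Projective A M := by
  rw [IsProjective.iff_projective, projective_iff_hasProjectiveDimensionLT_one]

lemma projective_iff_free {A : Type u} [CommRing A] [IsLocalRing A] {M : Type u}
    [AddCommGroup M] [Module A M] [Module.Finite A M] :
    Module.Projective A M ↔ Module.Free A M :=
  ⟨fun _ => Module.free_of_flat_of_isLocalRing, fun _ => inferInstance⟩

/-- Projective dimension does not change modulo a regular element. -/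
lemma hasProjectiveDimensionLE_quotSMulTop_iff {A : Type u} [CommRing A] [IsLocalRing A]
    [IsNoetherianRing A] {x : A} (hx : x ∈ maximalIdeal A) (hxA : x ∈ nonZeroDivisors A) (n : ℕ)
    (M : Type u) [AddCommGroup M] [Module A M] [Module.Finite A M] (hxM : IsSMulRegular M x) :
    HasProjectiveDimensionLE (ModuleCat.of (A ⧸ Ideal.span {x}) (QuotSMulTop x M)) n ↔
      HasProjectiveDimensionLE (ModuleCat.of A M) n := by
  have := isLocalRing_quotient_span_singleton hx
  have hx' : x ∈ (⊥ : Ideal A).jacobson := maximalIdeal_le_jacobson _ hx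
  induction n generalizing M with
  | zero =>
    have : Module.Finite (A ⧸ Ideal.span {x}) (QuotSMulTop x M) :=
      Module.Finite.of_restrictScalars_finite A _ _
    have : Module.FinitePresentation A M := Module.finitePresentation_of_finite A M
    rw [hasProjectiveDimensionLE_zero_iff, hasProjectiveDimensionLE_zero_iff,
      projective_iff_free, projective_iff_free, Module.free_quotSMulTop_iff_free A M hx' hxM]
  | succ n ih =>
    obtain ⟨P, _, _, _, _, f, hf⟩ := Module.exists_finite_presentation A M
    have hxP : IsSMulRegular P x := Module.Flat.isSMulRegular_of_nonZeroDivisors hxA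
    have hxK : IsSMulRegular (LinearMap.ker f) x :=
      hxP.of_injective (LinearMap.ker f).subtype (LinearMap.ker f).injective_subtype
    have hex : Function.Exact (LinearMap.ker f).subtype f := LinearMap.exact_subtype_ker_map f
    have hex0 : Function.Exact (0 : PUnit.{u+1} →ₗ[A] _) (LinearMap.ker f).subtype :=
      (LinearMap.exact_zero_iff_injective _ _).mpr (LinearMap.ker f).injective_subtype
    rw [hasProjectiveDimensionLE_succ_iff_of_exact _ f (LinearMap.ker f).injective_subtype hex hf]
    refine Iff.trans ?_ (ih (LinearMap.ker f) hxK)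
    have hsurj : Function.Surjective (algebraMap A (A ⧸ Ideal.span {x})) :=
      Ideal.Quotient.mk_surjective
    refine hasProjectiveDimensionLE_succ_iff_of_exact
      (LinearMap.extendScalarsOfSurjective hsurj (QuotSMulTop.map x (LinearMap.ker f).subtype))
      (LinearMap.extendScalarsOfSurjective hsurj (QuotSMulTop.map x f)) ?_
      (QuotSMulTop.map_exact x hex hf) (QuotSMulTop.map_surjective x hf) n
    have h1 := QuotSMulTop.map_first_exact_on_four_term_exact_of_isSMulRegular_last hex0 hex hxM
    rw [map_zero] at h1
    exact (LinearMap.exact_zero_iff_injective _ _).mp h1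

/-- Finite modules over a regular local ring have finite projective dimension. -/
lemma IsRegularLocalRing.exists_hasProjectiveDimensionLE (L : Type u) [CommRing L]
    [IsRegularLocalRing L] (M : Type u) [AddCommGroup M] [Module L M] [Module.Finite L M] :
    ∃ n, HasProjectiveDimensionLE (ModuleCat.of L M) n := by
  induction h : (maximalIdeal L).spanFinrank using Nat.strong_induction_on generalizing L M with
  | _ d ih =>
  by_cases hm : maximalIdeal L = ⊥
  · let := (isField_iff_maximalIdeal_eq.mpr hm).toField
    refine ⟨0, hasProjectiveDimensionLE_zero_iff.mpr ?_⟩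
    have : Module.Free L M := Module.Free.of_divisionRing L M
    infer_instance
  have := isDomain L
  obtain ⟨x, hx, hx2, -⟩ := exists_mem_maximalIdeal_notMem_sq hm (F := ∅) Set.finite_empty
    (by simp) (by simp)
  have hB := quotient_span_singleton hx hx2
  have hx0 : x ≠ 0 := by rintro rfl; exact hx2 (zero_mem _)
  obtain ⟨P, _, _, _, _, f, hf⟩ := Module.exists_finite_presentation L M
  have hxL : x ∈ nonZeroDivisors L := mem_nonZeroDivisors_of_ne_zero hx0
  have hxP : IsSMulRegular P x := Module.Flat.isSMulRegular_of_nonZeroDivisors hxL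
  have hxK : IsSMulRegular (LinearMap.ker f) x :=
    hxP.of_injective (LinearMap.ker f).subtype (LinearMap.ker f).injective_subtype
  have : Module.Finite (L ⧸ Ideal.span {x}) (QuotSMulTop x (LinearMap.ker f)) :=
    Module.Finite.of_restrictScalars_finite L _ _
  obtain ⟨n, hn⟩ := ih _
    (by have := spanFinrank_maximalIdeal_quotient_add_one_le hx hx2; omega)
    (L ⧸ Ideal.span {x}) (QuotSMulTop x (LinearMap.ker f)) rfl
  refine ⟨n + 1, ?_⟩
  rw [hasProjectiveDimensionLE_succ_iff_of_exact _ f (LinearMap.ker f).injective_subtype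
    (LinearMap.exact_subtype_ker_map f) hf]
  exact (hasProjectiveDimensionLE_quotSMulTop_iff hx hxL n _ hxK).mp hn

end FinitePD

section Serre

open CategoryTheory

/-- Over a local ring of depth zero, finite modules of finite projective dimension are free. -/
lemma free_of_hasProjectiveDimensionLE_of_depth_zero {A : Type u} [CommRing A] [IsLocalRing A]
    [IsNoetherianRing A] {s : A} (hs0 : s ≠ 0) (hs : ∀ a ∈ maximalIdeal A, a * s = 0) (n : ℕ)
    (M : Type u) [AddCommGroup M] [Module A M] [Module.Finite A M]
    (h : HasProjectiveDimensionLE (ModuleCat.of A M) n) : Module.Free A M := by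
  induction n generalizing M with
  | zero => rwa [hasProjectiveDimensionLE_zero_iff, projective_iff_free] at h
  | succ n ih =>
    obtain ⟨P, _, _, _, _, f, hf⟩ := Module.exists_finite_presentation A M
    have hex := LinearMap.exact_subtype_ker_map f
    have hK : Module.Free A (LinearMap.ker f) := ih _
      ((hasProjectiveDimensionLE_succ_iff_of_exact _ f (LinearMap.ker f).injective_subtype hex
        hf n).mp h)
    refine Module.free_of_lTensor_residueField_injective _ f hf hex ?_
    rw [injective_iff_map_eq_zero]
    intro z hz
    obtain ⟨y, rfl⟩ := TensorProduct.mk_surjective A (LinearMap.ker f) (ResidueField A)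
      Ideal.Quotient.mk_surjective z
    have hy : (y : P) ∈ maximalIdeal A • (⊤ : Submodule A P) := by
      rw [← Submodule.Quotient.mk_eq_zero,
        ← TensorProduct.quotTensorEquivQuotSMul_mk_one_tmul (maximalIdeal A)]
      exact (TensorProduct.quotTensorEquivQuotSMul P (maximalIdeal A)).map_eq_zero_iff.mpr hz
    have hsy : s • y = 0 := by
      apply Subtype.ext
      change s • (y : P) = 0
      generalize (y : P) = w at hy
      induction hy using Submodule.smul_induction_on' with
      | smul a ha w _ => rw [smul_smul, mul_comm, hs a ha, zero_smul]
      | add v _ w _ hv hw => rw [smul_add, hv, hw, add_zero]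
    have hyN : y ∈ maximalIdeal A • (⊤ : Submodule A (LinearMap.ker f)) := by
      let b := Module.Free.chooseBasis A (LinearMap.ker f)
      rw [← b.linearCombination_repr y, Finsupp.linearCombination_apply]
      refine Submodule.sum_mem _ fun i _ => Submodule.smul_mem_smul ?_ trivial
      by_contra hi
      have hu : IsUnit (b.repr y i) := by simpa using hi
      have h1 : s * b.repr y i = 0 := by
        simpa using DFunLike.congr_fun (congrArg b.repr hsy) i
      exact hs0 (hu.mul_left_eq_zero.mp h1)
    rw [← Submodule.Quotient.mk_eq_zero,
      ← TensorProduct.quotTensorEquivQuotSMul_mk_one_tmul (maximalIdeal A)] at hyN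
    exact (TensorProduct.quotTensorEquivQuotSMul
      (LinearMap.ker f) (maximalIdeal A)).map_eq_zero_iff.mp
      hyN

/-- A socle element outside `m • N` splits off a copy of the residue field. -/
lemma exists_retract_residueField {B : Type*} [CommRing B] [IsLocalRing B] {N : Type*}
    [AddCommGroup N] [Module B N] {y : N} (hy : y ∉ maximalIdeal B • (⊤ : Submodule B N))
    (hmy : ∀ a ∈ maximalIdeal B, a • y = 0) :
    ∃ (i : B ⧸ maximalIdeal B →ₗ[B] N) (r : N →ₗ[B] B ⧸ maximalIdeal B),
      r ∘ₗ i = LinearMap.id := by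
  let := Ideal.Quotient.field (maximalIdeal B)
  let v : N ⧸ maximalIdeal B • (⊤ : Submodule B N) := Submodule.Quotient.mk y
  have hv : v ≠ 0 := by rwa [ne_eq, Submodule.Quotient.mk_eq_zero]
  obtain ⟨g, hg⟩ :=
    (LinearMap.toSpanSingleton (B ⧸ maximalIdeal B) _ v).exists_leftInverse_of_injective
    (LinearMap.ker_eq_bot.mpr (smul_left_injective _ hv))
  refine ⟨(maximalIdeal B).liftQ (LinearMap.toSpanSingleton B N y)
    (fun a ha => by simpa using hmy a ha), (g.restrictScalars B) ∘ₗ Submodule.mkQ _, ?_⟩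
  have hgv : g v = 1 := by simpa using LinearMap.congr_fun hg 1
  apply Submodule.linearMap_qext
  ext
  change g (Submodule.Quotient.mk ((1 : B) • y)) = 1
  rwa [one_smul]

/-- A Noetherian local ring whose residue field has finite projective dimension is regular. -/
lemma isRegularLocalRing_of_hasProjectiveDimensionLE (A : Type u) [CommRing A] [IsLocalRing A]
    [IsNoetherianRing A] (n : ℕ)
    (h : HasProjectiveDimensionLE (ModuleCat.of A (A ⧸ maximalIdeal A)) n) :
    IsRegularLocalRing A := by
  induction hd : (maximalIdeal A).spanFinrank using Nat.strong_induction_on generalizing A with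
  | _ d ih =>
  by_cases hm : maximalIdeal A = ⊥
  · apply IsRegularLocalRing.of_spanFinrank_maximalIdeal_le
    rw [hm, Submodule.spanFinrank_bot]
    exact_mod_cast ringKrullDim_nonneg_of_nontrivial
  by_cases hass : maximalIdeal A ∈ associatedPrimes A A
  · exfalso
    obtain ⟨-, s, hs⟩ := isAssociatedPrime_iff.mp hass
    have hs' : ∀ a, a ∈ maximalIdeal A ↔ a * s = 0 := by
      intro a
      rw [hs, Submodule.mem_colon_singleton, Submodule.mem_bot, smul_eq_mul]
    have hs0 : s ≠ 0 := by
      rintro rfl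
      exact (maximalIdeal.isMaximal A).ne_top (Ideal.eq_top_iff_one _ |>.mpr (by simp [hs']))
    have hfree := free_of_hasProjectiveDimensionLE_of_depth_zero hs0
      (fun a ha => (hs' a).mp ha) n _ h
    refine hm ((Submodule.eq_bot_iff _).mpr fun a ha => ?_)
    have h1 : Module.annihilator A (A ⧸ maximalIdeal A) = maximalIdeal A :=
      Ideal.annihilator_quotient
    rw [← h1, Module.mem_annihilator] at ha
    exact FaithfulSMul.eq_of_smul_eq_smul (α := A ⧸ maximalIdeal A) fun w => by
      rw [ha w, zero_smul]
  obtain ⟨x, hx, hx2, hxa⟩ := exists_mem_maximalIdeal_notMem_sq hm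
    (associatedPrimes.finite A A) (fun p hp => hp.1) hass
  have hxA : x ∈ nonZeroDivisors A := by
    by_contra hcon
    have : x ∈ (nonZeroDivisors A : Set A)ᶜ := hcon
    rw [← biUnion_associatedPrimes_eq_compl_nonZeroDivisors] at this
    obtain ⟨p, hp, hxp⟩ := Set.mem_iUnion₂.mp this
    exact hxa p hp hxp
  have hB := isLocalRing_quotient_span_singleton hx
  have hle := spanFinrank_maximalIdeal_quotient_add_one_le hx hx2
  have hn : HasProjectiveDimensionLE (ModuleCat.of A (maximalIdeal A)) n :=
    (hasProjectiveDimensionLE_succ_iff_of_exact _ _ (maximalIdeal A).injective_subtype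
      (LinearMap.exact_subtype_mkQ (maximalIdeal A)) (Submodule.mkQ_surjective _) n).mp
      (hasProjectiveDimensionLT_of_ge _ (n + 1) _ (by omega))
  have hxm : IsSMulRegular (maximalIdeal A) x :=
    IsSMulRegular.of_injective (maximalIdeal A).subtype (maximalIdeal A).injective_subtype
      (Module.Flat.isSMulRegular_of_nonZeroDivisors (M := A) hxA)
  have hn' := (hasProjectiveDimensionLE_quotSMulTop_iff hx hxA n _ hxm).mpr hn
  let y : QuotSMulTop x (maximalIdeal A) := Submodule.Quotient.mk ⟨x, hx⟩
  have hmap : maximalIdeal (A ⧸ Ideal.span {x}) =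
      (maximalIdeal A).map (Ideal.Quotient.mk (Ideal.span {x})) :=
    (map_maximalIdeal_of_surjective _ Ideal.Quotient.mk_surjective).symm
  have hmem : ∀ b ∈ maximalIdeal (A ⧸ Ideal.span {x}), ∃ a ∈ maximalIdeal A,
      Ideal.Quotient.mk (Ideal.span {x}) a = b := by
    intro b hb
    rw [hmap] at hb
    exact (Ideal.mem_map_iff_of_surjective _ Ideal.Quotient.mk_surjective).mp hb
  obtain ⟨i, r, hir⟩ := exists_retract_residueField (B := A ⧸ Ideal.span {x}) (y := y) (by
    intro hcon
    let ψ : QuotSMulTop x (maximalIdeal A) →ₗ[A] (maximalIdeal A).Cotangent :=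
      Submodule.liftQ _ (maximalIdeal A).toCotangent (by
        rintro _ ⟨w, -, rfl⟩
        change (maximalIdeal A).toCotangent (x • w) = 0
        rw [Ideal.toCotangent_eq_zero, pow_two]
        exact Ideal.mul_mem_mul hx w.2)
    have key : ∀ w ∈ maximalIdeal (A ⧸ Ideal.span {x}) •
        (⊤ : Submodule (A ⧸ Ideal.span {x}) (QuotSMulTop x (maximalIdeal A))), ψ w = 0 := by
      intro w hw
      induction hw using Submodule.smul_induction_on' with
      | smul b hb w _ =>
        obtain ⟨a, ha, rfl⟩ := hmem b hb
        obtain ⟨w, rfl⟩ := Submodule.Quotient.mk_surjective _ w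
        change (maximalIdeal A).toCotangent (a • w) = 0
        rw [Ideal.toCotangent_eq_zero, pow_two]
        exact Ideal.mul_mem_mul ha w.2
      | add v _ w _ hv hw => rw [map_add, hv, hw, add_zero]
    have := key y hcon
    change (maximalIdeal A).toCotangent ⟨x, hx⟩ = 0 at this
    rw [Ideal.toCotangent_eq_zero] at this
    exact hx2 this) (by
    intro b hb
    obtain ⟨a, ha, rfl⟩ := hmem b hb
    change Submodule.Quotient.mk (a • (⟨x, hx⟩ : maximalIdeal A)) = _
    rw [Submodule.Quotient.mk_eq_zero]
    refine ⟨⟨a, ha⟩, trivial, Subtype.ext (mul_comm _ _)⟩)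
  have hret : Retract (ModuleCat.of (A ⧸ Ideal.span {x})
      ((A ⧸ Ideal.span {x}) ⧸ maximalIdeal (A ⧸ Ideal.span {x})))
      (ModuleCat.of (A ⧸ Ideal.span {x}) (QuotSMulTop x (maximalIdeal A))) :=
    { i := ModuleCat.ofHom i
      r := ModuleCat.ofHom r
      retract := by rw [← ModuleCat.ofHom_comp, hir, ModuleCat.ofHom_id] }
  have hreg := ih _ (by omega) (A ⧸ Ideal.span {x}) (hret.hasProjectiveDimensionLT (n + 1)) rfl
  exact IsRegularLocalRing.of_surjective_of_ker_eq_span (Ideal.Quotient.mk (Ideal.span {x}))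
    Ideal.Quotient.mk_surjective Ideal.mk_ker (ringKrullDim_quotient_succ_le_of_nonZeroDivisor hxA)

/-- Localizations of regular local rings at primes are regular. -/
lemma IsRegularLocalRing.localization_atPrime (L : Type u) [CommRing L] [IsRegularLocalRing L]
    (q : Ideal L) [q.IsPrime] : IsRegularLocalRing (Localization.AtPrime q) := by
  obtain ⟨n, hn⟩ := exists_hasProjectiveDimensionLE L (L ⧸ q)
  have := ModuleCat.localizedModule_hasProjectiveDimensionLE n q.primeCompl (ModuleCat.of L (L ⧸ q))
  have : IsNoetherianRing (Localization.AtPrime q) :=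
    IsLocalization.isNoetherianRing q.primeCompl _ inferInstance
  have hq : maximalIdeal (Localization.AtPrime q) =
      Submodule.localized' (Localization.AtPrime q) q.primeCompl
        (Algebra.linearMap L (Localization.AtPrime q)) q := by
    rw [Ideal.localized'_eq_map, Localization.AtPrime.map_eq_maximalIdeal]
  apply isRegularLocalRing_of_hasProjectiveDimensionLE _ n
  rw [hq]
  have : IsLocalizedModule q.primeCompl
      ((ModuleCat.of L (L ⧸ q)).localizedModuleMkLinearMap q.primeCompl) :=
    ModuleCat.localizedModule_isLocalizedModule (ModuleCat.of L (L ⧸ q)) q.primeCompl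
  let e := IsLocalizedModule.linearEquiv q.primeCompl
    ((ModuleCat.of L (L ⧸ q)).localizedModuleMkLinearMap q.primeCompl)
    (Submodule.toLocalizedQuotient' (Localization.AtPrime q) q.primeCompl
        (Algebra.linearMap L (Localization.AtPrime q)) q)
  exact ModuleCat.hasProjectiveDimensionLE_of_linearEquiv
    (e.extendScalarsOfIsLocalization q.primeCompl (Localization.AtPrime q)) n

end Serre

section NonExceptional

lemma surjective_localRingHom_and_ker {P S : Type*} [CommRing P] [CommRing S] (φ : P →+* S)
    (hφ : Function.Surjective φ) (Q : Ideal P) [Q.IsPrime] (p : Ideal S) [p.IsPrime]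
    (hQ : Q = p.comap φ) :
    Function.Surjective (Localization.localRingHom Q p φ hQ) ∧
      RingHom.ker (Localization.localRingHom Q p φ hQ) =
        (RingHom.ker φ).map (algebraMap P (Localization.AtPrime Q)) := by
  have hT : Q.primeCompl.map φ = p.primeCompl := by
    ext y
    constructor
    · rintro ⟨x, hx, rfl⟩
      exact fun h => hx (by rw [hQ]; exact h)
    · intro hy
      obtain ⟨x, rfl⟩ := hφ y
      exact ⟨x, fun h => hy (by rw [hQ] at h; exact h), rfl⟩
  refine ⟨?_, IsLocalization.ker_map _ φ hT⟩
  intro z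
  obtain ⟨s, d, rfl⟩ := IsLocalization.exists_mk'_eq p.primeCompl z
  obtain ⟨f, rfl⟩ := hφ s
  obtain ⟨d, hd⟩ := d
  obtain ⟨e, rfl⟩ := hφ d
  exact ⟨IsLocalization.mk' _ f (⟨e, fun h => hd (by rw [hQ] at h; exact h)⟩ : Q.primeCompl),
    Localization.localRingHom_mk' ..⟩

/-- If every element of `S` becomes an element of `R` after multiplying by a power of `t`, then
`S` is regular at the primes not containing `t`. -/
lemma isRegularLocalRing_localization_of_notMem {R : Type u} {S : Type*} [CommRing R] [CommRing S]
    [Algebra R S] [IsRegularLocalRing R] (hinj : Function.Injective (algebraMap R S)) {t : R}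
    (ht : ∀ s : S, ∃ (N : ℕ) (r : R), algebraMap R S t ^ N * s = algebraMap R S r)
    (p : Ideal S) [p.IsPrime] (htp : algebraMap R S t ∉ p) :
    IsRegularLocalRing (Localization.AtPrime p) := by
  have hpow (N : ℕ) : algebraMap R S t ^ N ∉ p :=
    fun h => htp (Ideal.IsPrime.mem_of_pow_mem ‹_› N h)
  let q := p.comap (algebraMap R S)
  have hloc : IsLocalization.AtPrime (Localization.AtPrime p) q := by
    refine ⟨fun r => ?_, fun z => ?_, fun {a b} hab => ?_⟩
    · rw [IsScalarTower.algebraMap_apply R S]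
      exact IsLocalization.map_units _ (⟨algebraMap R S r, r.2⟩ : p.primeCompl)
    · obtain ⟨s, d, rfl⟩ := IsLocalization.exists_mk'_eq p.primeCompl z
      obtain ⟨N, a, ha⟩ := ht s
      obtain ⟨M, b, hb⟩ := ht d
      refine ⟨⟨t ^ M * a, ⟨t ^ N * b, ?_⟩⟩, ?_⟩
      · change algebraMap R S (t ^ N * b) ∉ p
        rw [map_mul, map_pow, ← hb, ← mul_assoc]
        exact fun h => ((Ideal.IsPrime.mem_or_mem ‹_› h).elim
          (fun h => (Ideal.IsPrime.mem_or_mem ‹_› h).elim (hpow N) (hpow M)) d.2)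
      · have h : algebraMap R S (t ^ N * b) * s = algebraMap R S (t ^ M * a) * d := by
          rw [map_mul, map_mul, ← ha, ← hb, map_pow, map_pow]
          ring
        change IsLocalization.mk' _ s d * algebraMap R _ (t ^ N * b) = algebraMap R _ (t ^ M * a)
        rw [IsScalarTower.algebraMap_apply R S, IsScalarTower.algebraMap_apply R S _ (t ^ M * a),
          mul_comm, IsLocalization.mul_mk'_eq_mk'_of_mul, IsLocalization.mk'_eq_iff_eq_mul,
          ← map_mul, h]
    · rw [IsScalarTower.algebraMap_apply R S, IsScalarTower.algebraMap_apply R S _ b] at hab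
      obtain ⟨c, hc⟩ := (IsLocalization.eq_iff_exists p.primeCompl _).mp hab
      obtain ⟨N, r, hr⟩ := ht c
      refine ⟨⟨r, ?_⟩, hinj ?_⟩
      · change algebraMap R S r ∉ p
        rw [← hr]
        exact fun h => (Ideal.IsPrime.mem_or_mem ‹_› h).elim (hpow N) c.2
      · simp only [map_mul, ← hr]
        rw [mul_assoc, hc, mul_assoc]
  have := IsRegularLocalRing.localization_atPrime R q
  exact IsRegularLocalRing.of_ringEquiv
    (IsLocalization.algEquiv q.primeCompl (Localization.AtPrime q)
      (Localization.AtPrime p)).toRingEquiv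

open MvPolynomial in
/-- Modulo the relations `t * Xᵢ = xᵢ`, a power of `t` clears the variables. -/
lemma exists_pow_mul_sub_mem_span {R ι : Type*} [CommRing R] (t : R) (x : ι → R)
    (f : MvPolynomial ι R) :
    ∃ (N : ℕ) (r : R), C t ^ N * f - C r ∈
      Ideal.span (Set.range fun i => (C t * X i - C (x i) : MvPolynomial ι R)) := by
  induction f using MvPolynomial.induction_on with
  | C a => exact ⟨0, a, by simp⟩
  | add f g hf hg =>
    obtain ⟨N, a, ha⟩ := hf
    obtain ⟨M, b, hb⟩ := hg
    refine ⟨N + M, t ^ M * a + t ^ N * b, ?_⟩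
    convert add_mem (Ideal.mul_mem_left _ (C t ^ M) ha) (Ideal.mul_mem_left _ (C t ^ N) hb) using 1
    simp only [map_add, map_mul, map_pow]
    ring
  | mul_X f i hf =>
    obtain ⟨N, a, ha⟩ := hf
    refine ⟨N + 1, a * x i, ?_⟩
    have hi := Ideal.subset_span (Set.mem_range_self
      (f := fun i => (C t * X i - C (x i) : MvPolynomial ι R)) i)
    convert add_mem (Ideal.mul_mem_left _ (C t * X i) ha) (Ideal.mul_mem_left _ (C a) hi) using 1
    simp only [map_mul]
    ring

end NonExceptional

section Exceptional

lemma isRegularLocalRing_quotient_span_finset {L : Type*} {B : Type*} [CommRing L] [CommRing B]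
    [IsLocalRing L] [IsNoetherianRing L] [IsRegularLocalRing B] (f : L →+* B)
    (hf : Function.Surjective f) (s : Finset L) (t : L)
    (hker : RingHom.ker f = Ideal.span (s : Set L) ⊔ Ideal.span {t})
    (hdim : ringKrullDim B + 1 + (s.card : ℕ) ≤ ringKrullDim L) :
    IsRegularLocalRing (L ⧸ Ideal.span (s : Set L)) ∧ t ∉ Ideal.span (s : Set L) := by
  have hsker : Ideal.span (s : Set L) ≤ RingHom.ker f := hker ▸ le_sup_left
  have hsmax : Ideal.span (s : Set L) ≤ maximalIdeal L :=
    hsker.trans (le_maximalIdeal (RingHom.ker_ne_top f))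
  have hnt : Nontrivial (L ⧸ Ideal.span (s : Set L)) :=
    Ideal.Quotient.nontrivial_iff.mpr fun h =>
      (maximalIdeal.isMaximal L).ne_top (top_le_iff.mp (h ▸ hsmax))
  have hloc : IsLocalRing (L ⧸ Ideal.span (s : Set L)) :=
    IsLocalRing.of_surjective' _ Ideal.Quotient.mk_surjective
  have hle : ringKrullDim B + 1 ≤ ringKrullDim (L ⧸ Ideal.span (s : Set L)) := by
    have h := ringKrullDim_le_ringKrullDim_quotient_add_card s (by
      rw [ringJacobson_eq_maximalIdeal]
      exact fun a ha => hsmax (Ideal.subset_span ha))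
    exact ENat.WithBot.add_le_add_natCast_right_iff.mp (hdim.trans h)
  let g := Ideal.Quotient.lift (Ideal.span (s : Set L)) f fun a ha => hsker ha
  have hg : Function.Surjective g := Ideal.Quotient.lift_surjective_of_surjective _ _ hf
  have hkg : RingHom.ker g = Ideal.span {Ideal.Quotient.mk _ t} := by
    rw [Ideal.ker_quotient_lift f hsker, hker, Ideal.map_sup, Ideal.map_quotient_self, bot_sup_eq,
      Ideal.map_span, Set.image_singleton]
  refine ⟨IsRegularLocalRing.of_surjective_of_ker_eq_span g hg hkg hle, fun ht => ?_⟩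
  rw [Ideal.Quotient.eq_zero_iff_mem.mpr ht, Ideal.span_singleton_eq_bot.mpr rfl] at hkg
  have h := ringKrullDim_eq_of_ringEquiv
    (RingEquiv.ofBijective g ⟨(RingHom.injective_iff_ker_eq_bot g).mpr hkg, hg⟩)
  rw [h] at hle
  rw [← (isRegularLocalRing_iff B).mp ‹_›] at hle
  have : (maximalIdeal B).spanFinrank + 1 ≤ (maximalIdeal B).spanFinrank := by exact_mod_cast hle
  omega

open MvPolynomial in
/-- At a prime of the polynomial ring over a regular local ring lying over the maximal ideal,
the fiber is regular and the dimension is the expected one. -/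
lemma isRegularLocalRing_localization_map_quotient {R : Type u} {ι : Type} [CommRing R]
    [IsRegularLocalRing R] [Fintype ι] (Q : Ideal (MvPolynomial ι R)) [Q.IsPrime]
    (hQ : (maximalIdeal R).map C ≤ Q)
    (p : Ideal (MvPolynomial ι R ⧸ (maximalIdeal R).map (C : R →+* MvPolynomial ι R)))
    [p.IsPrime] (hp : p = Q.map (Ideal.Quotient.mk _)) :
    IsRegularLocalRing (Localization.AtPrime p) ∧
      ringKrullDim (Localization.AtPrime Q) =
        ringKrullDim (Localization.AtPrime p) + ringKrullDim R := by
  constructor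
  · let _ := Ideal.Quotient.field (maximalIdeal R)
    have := IsRegularRing.of_ringEquiv
      (quotientEquivQuotientMvPolynomial (σ := ι) (maximalIdeal R)).toRingEquiv
    exact IsRegularRing.isRegularLocalRing_localization p
  · have hover : Q.LiesOver (maximalIdeal R) := by
      refine ⟨?_⟩
      refine (maximalIdeal.isMaximal R).eq_of_le (Ideal.IsPrime.under R Q).ne_top ?_
      exact Ideal.map_le_iff_le_comap.mp hQ
    have h := Ideal.height_eq_height_add_of_liesOver_of_hasGoingDown (maximalIdeal R) Q
    rw [IsLocalization.AtPrime.ringKrullDim_eq_height Q (Localization.AtPrime Q),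
      IsLocalization.AtPrime.ringKrullDim_eq_height p (Localization.AtPrime p),
      ← maximalIdeal_height_eq_ringKrullDim, h, hp,
      add_comm]
    exact_mod_cast rfl

open MvPolynomial in
/-- If `S` is generated over a regular local ring `R` by the quotients `xᵢ / t`, where `t` and the
`xᵢ` form a regular system of parameters, then `S` is regular at the primes containing `t`. -/
lemma isRegularLocalRing_localization_of_mem {R S : Type u} {ι : Type} [CommRing R]
    [IsRegularLocalRing R] [Fintype ι] [CommRing S] [Algebra R S]
    (hinj : Function.Injective (algebraMap R S)) (t : R) (x : ι → R)
    (hdim : ringKrullDim R = (Fintype.card ι : ℕ) + 1)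
    (hspan : maximalIdeal R = Ideal.span (insert t (Set.range x)))
    (φ : MvPolynomial ι R →ₐ[R] S) (hφ : Function.Surjective φ)
    (hφX : ∀ i, algebraMap R S t * φ (X i) = algebraMap R S (x i))
    (p : Ideal S) [p.IsPrime] (htp : algebraMap R S t ∈ p) :
    IsRegularLocalRing (Localization.AtPrime p) := by
  classical
  let r : ι → MvPolynomial ι R := fun i => C t * X i - C (x i)
  let Q : Ideal (MvPolynomial ι R) := p.comap (φ : MvPolynomial ι R →+* S)
  have hφC (a : R) : φ (C a) = algebraMap R S a := φ.commutes a
  have hr (i) : φ (r i) = 0 := by simp only [r, map_sub, map_mul, hφC, hφX, sub_self]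
  have hm : (maximalIdeal R).map (C : R →+* MvPolynomial ι R) =
      Ideal.span (Set.range r) ⊔ Ideal.span {C t} := by
    apply le_antisymm
    · rw [hspan, Ideal.map_span, Ideal.span_le]
      have ht : (C t : MvPolynomial ι R) ∈ Ideal.span (Set.range r) ⊔ Ideal.span {C t} :=
        Ideal.mem_sup_right (Ideal.mem_span_singleton_self _)
      rintro _ ⟨a, rfl | ⟨i, rfl⟩, rfl⟩
      · exact ht
      · have h : (C (x i) : MvPolynomial ι R) = X i * C t - r i := by
          simp only [r]
          ring
        rw [h]
        exact sub_mem (Ideal.mul_mem_left _ _ ht)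
          (Ideal.mem_sup_left (Ideal.subset_span ⟨i, rfl⟩))
    · have ht : (C t : MvPolynomial ι R) ∈ (maximalIdeal R).map C :=
        Ideal.mem_map_of_mem _ (hspan ▸ Ideal.subset_span (Set.mem_insert _ _))
      refine sup_le (Ideal.span_le.mpr ?_) ((Ideal.span_singleton_le_iff_mem _).mpr ht)
      rintro _ ⟨i, rfl⟩
      exact sub_mem (Ideal.mul_mem_right _ _ ht) (Ideal.mem_map_of_mem _
        (hspan ▸ Ideal.subset_span (Set.mem_insert_of_mem _ (Set.mem_range_self i))))
  have hQ : (maximalIdeal R).map (C : R →+* MvPolynomial ι R) ≤ Q := by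
    rw [hm]
    refine sup_le (Ideal.span_le.mpr ?_) ((Ideal.span_singleton_le_iff_mem _).mpr ?_)
    · rintro _ ⟨i, rfl⟩
      change φ (r i) ∈ p
      rw [hr]
      exact zero_mem _
    · change φ (C t) ∈ p
      rwa [hφC]
  let π := Ideal.Quotient.mk ((maximalIdeal R).map (C : R →+* MvPolynomial ι R))
  have hπ : Function.Surjective π := Ideal.Quotient.mk_surjective
  have hπQ : RingHom.ker π ≤ Q := by rwa [Ideal.mk_ker]
  have hprime : (Q.map π).IsPrime := Ideal.map_isPrime_of_surjective hπ hπQ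
  obtain ⟨hB, hdimB⟩ := isRegularLocalRing_localization_map_quotient Q hQ (Q.map π) rfl
  obtain ⟨hf, hkf⟩ := surjective_localRingHom_and_ker π hπ Q (Q.map π) (by
    rw [Ideal.comap_map_of_surjective' π hπ, sup_eq_left.mpr hπQ])
  obtain ⟨hg, hkg⟩ := surjective_localRingHom_and_ker (φ : MvPolynomial ι R →+* S) hφ Q p rfl
  let e := algebraMap (MvPolynomial ι R) (Localization.AtPrime Q)
  let s : Finset (Localization.AtPrime Q) := Finset.univ.image fun i => e (r i)
  have hs : Ideal.span (s : Set (Localization.AtPrime Q)) = (Ideal.span (Set.range r)).map e := by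
    rw [Ideal.map_span, ← Set.range_comp, Finset.coe_image, Finset.coe_univ, Set.image_univ]
    rfl
  obtain ⟨hA, htA⟩ := isRegularLocalRing_quotient_span_finset _ hf s (e (C t))
    (by rw [hkf, Ideal.mk_ker, hm, Ideal.map_sup, hs, Ideal.map_span _ {C t}, Set.image_singleton])
    (by
      have hcard : s.card ≤ Fintype.card ι := Finset.card_image_le
      rw [hdimB, hdim, add_assoc, add_comm (1 : WithBot ℕ∞)]
      gcongr)
  have := IsRegularLocalRing.isDomain (Localization.AtPrime Q ⧸ Ideal.span
    (s : Set (Localization.AtPrime Q)))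
  have hker : Ideal.span (s : Set (Localization.AtPrime Q)) =
      RingHom.ker (Localization.localRingHom Q p (φ : MvPolynomial ι R →+* S) rfl) := by
    rw [hkg, hs]
    apply le_antisymm
    · refine Ideal.map_mono (Ideal.span_le.mpr ?_)
      rintro _ ⟨i, rfl⟩
      exact hr i
    · rw [Ideal.map_le_iff_le_comap]
      intro f hf
      obtain ⟨N, a, ha⟩ := exists_pow_mul_sub_mem_span t x f
      have hφf : φ f = 0 := hf
      have hφr (g) (hg : g ∈ Ideal.span (Set.range r)) : φ g = 0 := by
        have : Ideal.span (Set.range r) ≤ RingHom.ker φ := by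
          refine Ideal.span_le.mpr ?_
          rintro _ ⟨i, rfl⟩
          exact hr i
        exact this hg
      have ha0 : a = 0 := by
        have h := hφr _ ha
        rw [map_sub, map_mul, hφf, hφC, mul_zero, zero_sub, neg_eq_zero] at h
        exact hinj (h.trans (map_zero _).symm)
      rw [ha0, map_zero, sub_zero] at ha
      have h := Ideal.mem_map_of_mem e ha
      rw [Ideal.mem_comap]
      rw [map_mul, map_pow] at h
      rw [← hs] at h ⊢
      rw [← Ideal.Quotient.eq_zero_iff_mem] at h htA ⊢
      rw [map_mul, map_pow] at h
      exact (mul_eq_zero.mp h).resolve_left (pow_ne_zero _ htA)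
  exact IsRegularLocalRing.of_ringEquiv
    (R := Localization.AtPrime Q ⧸ Ideal.span (s : Set (Localization.AtPrime Q)))
    ((Ideal.quotEquivOfEq hker).trans
    (RingHom.quotientKerEquivOfSurjective hg))

end Exceptional

section IsRegLoc

lemma nuIdeal_eq_maximalIdeal (A : Type*) [CommRing A] [IsLocalRing A] :
    nuIdeal A = maximalIdeal A := by
  refine le_antisymm (Ideal.span_le.mpr fun a ha => (mem_maximalIdeal a).mpr ha) fun a ha => ?_
  exact Ideal.subset_span ((mem_maximalIdeal a).mp ha)

lemma IsRegLoc.isRegularLocalRing {A : Type*} [CommRing A] (h : IsRegLoc A) :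
    IsRegularLocalRing A := by
  obtain ⟨_, _, s, hs, hd⟩ := h
  rw [nuIdeal_eq_maximalIdeal] at hs
  refine IsRegularLocalRing.of_spanFinrank_maximalIdeal_le A ?_
  rw [← hd, ← hs]
  have h : (Ideal.span (s : Set A)).spanFinrank ≤ s.card := by
    simpa using Submodule.spanFinrank_span_le_ncard_of_finite (R := A) s.finite_toSet
  change _ ≤ ((s.card : ℕ) : WithBot ℕ∞)
  exact_mod_cast h

lemma IsRegularLocalRing.isRegLoc (A : Type*) [CommRing A] [IsRegularLocalRing A] :
    IsRegLoc A := by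
  obtain ⟨s, hcard, hs⟩ := Submodule.FG.exists_span_finset_card_eq_spanFinrank
    (IsNoetherian.noetherian (maximalIdeal A))
  refine ⟨inferInstance, inferInstance, s, ?_, ?_⟩
  · rw [nuIdeal_eq_maximalIdeal]
    exact hs
  · rw [hcard]
    exact (isRegularLocalRing_iff A).mp inferInstance

end IsRegLoc

/-- Let `(R, m)` be a local regular domain of dimension `n > 1`, let
`x₁,...,xₙ` generate `m`, and let `S = R[x₂/x₁,...,xₙ/x₁]` be the subring of `Frac(R)`
generated by `R` and the fractions `xⱼ/x₁`.  Then `S` is a regular ring, i.e. `S_p` is a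
regular local ring for every prime ideal `p` of `S`. -/
theorem quadratic_transform_regular (R : Type*) [CommRing R] [IsDomain R] [IsLocalRing R]
    (n : ℕ) (hn : 1 < n) (hreg : IsRegLoc R)
    (hdim : ringKrullDim R = (n : ℕ))
    (x : Fin n → R) (hx : Ideal.span (Set.range x) = maximalIdeal R)
    (i0 : Fin n) (hi0 : (i0 : ℕ) = 0)
    (S : Subalgebra R (FractionRing R))
    (hS : S = Algebra.adjoin R (Set.range fun i : Fin n =>
      algebraMap R (FractionRing R) (x i) / algebraMap R (FractionRing R) (x i0))) :
    ∀ p : Ideal S, ∀ hp : p.IsPrime, IsRegLoc (@Localization.AtPrime S _ p hp) := by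

  subst hS
  intro p hp
  have hR := hreg.isRegularLocalRing
  let K := FractionRing R
  let S := Algebra.adjoin R (Set.range fun i : Fin n =>
      algebraMap R (FractionRing R) (x i) / algebraMap R (FractionRing R) (x i0))
  let ι := {i : Fin n // i ≠ i0}
  have hcard : Fintype.card ι + 1 = n := by
    have := Fintype.card_subtype_compl (fun i : Fin n => i = i0)
    simp only [Fintype.card_fin, Fintype.card_subtype_eq] at this
    have h2 : Fintype.card ι = n - 1 := this
    omega
  have hrange : Set.range x = insert (x i0) (Set.range fun i : ι => x i) := by
    ext a
    constructor
    · rintro ⟨i, rfl⟩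
      by_cases hi : i = i0
      · exact Or.inl (by rw [hi])
      · exact Or.inr ⟨⟨i, hi⟩, rfl⟩
    · rintro (rfl | ⟨i, rfl⟩)
      exacts [⟨i0, rfl⟩, ⟨i, rfl⟩]
  have ht : x i0 ≠ 0 := by
    intro h
    have h1 : maximalIdeal R = Ideal.span (Set.range fun i : ι => x i) := by
      rw [← hx, hrange, h, Ideal.span_insert_zero]
    have h2 := (isRegularLocalRing_iff R).mp hR
    have h3 : (maximalIdeal R).spanFinrank ≤ Fintype.card ι := by
      rw [h1]
      refine (Submodule.spanFinrank_span_le_ncard_of_finite (R := R) (Set.finite_range _)).trans ?_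
      rw [← Set.image_univ]
      refine (Set.ncard_image_le Set.finite_univ).trans ?_
      rw [Set.ncard_univ, Nat.card_eq_fintype_card]
    rw [hdim] at h2
    have h4 : (maximalIdeal R).spanFinrank = n := by exact_mod_cast h2
    omega
  have htK : algebraMap R K (x i0) ≠ 0 :=
    (map_ne_zero_iff _ (IsFractionRing.injective R K)).mpr ht
  have hinj : Function.Injective (algebraMap R S) := fun a b hab =>
    IsFractionRing.injective R K (congrArg Subtype.val hab)
  let y : Fin n → S := fun i => ⟨algebraMap R K (x i) / algebraMap R K (x i0),
    Algebra.subset_adjoin ⟨i, rfl⟩⟩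
  let φ : MvPolynomial ι R →ₐ[R] S := MvPolynomial.aeval fun i : ι => y i
  have hφX (i : ι) : algebraMap R S (x i0) * φ (MvPolynomial.X i) = algebraMap R S (x i) := by
    rw [MvPolynomial.aeval_X]
    exact Subtype.ext (mul_div_cancel₀ _ htK)
  have hφ : Function.Surjective φ := by
    have hle : S ≤ (S.val.comp φ).range := by
      refine Algebra.adjoin_le ?_
      rintro _ ⟨i, rfl⟩
      by_cases hi : i = i0
      · subst hi
        exact ⟨1, by rw [map_one]; exact (div_self htK).symm⟩
      · refine ⟨MvPolynomial.X ⟨i, hi⟩, ?_⟩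
        change ((φ (MvPolynomial.X _) : S) : K) = _
        rw [MvPolynomial.aeval_X]
    rintro ⟨s, hs⟩
    obtain ⟨f, hf⟩ := hle hs
    exact ⟨f, Subtype.ext hf⟩
  by_cases htp : algebraMap R S (x i0) ∈ p
  · have := isRegularLocalRing_localization_of_mem hinj (x i0) (fun i : ι => x i)
      (by rw [hdim]; exact_mod_cast hcard.symm) (by rw [← hx, hrange]) φ hφ hφX p htp
    exact IsRegularLocalRing.isRegLoc _
  · have := isRegularLocalRing_localization_of_notMem hinj (t := x i0) (fun s => by
      obtain ⟨f, rfl⟩ := hφ s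
      obtain ⟨N, r, hr⟩ := exists_pow_mul_sub_mem_span (x i0) (fun i : ι => x i) f
      refine ⟨N, r, ?_⟩
      have hker : Ideal.span (Set.range fun i : ι => (MvPolynomial.C (x i0) * MvPolynomial.X i -
          MvPolynomial.C (x i) : MvPolynomial ι R)) ≤ RingHom.ker φ := by
        refine Ideal.span_le.mpr ?_
        rintro _ ⟨i, rfl⟩
        change φ _ = 0
        rw [map_sub, map_mul, MvPolynomial.algHom_C, MvPolynomial.algHom_C, hφX, sub_self]
      have h : φ _ = 0 := hker hr
      rwa [map_sub, map_mul, map_pow, MvPolynomial.algHom_C, MvPolynomial.algHom_C,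
        sub_eq_zero] at h) p htp
    exact IsRegularLocalRing.isRegLoc _

end
end
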